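/- Let k ∈ ℝ with k ≠ 0. For every y ≠ 0, writing R = ‖y‖ and u = y/R, the homogeneous-medium dyadic Green's function G_E = (I + ∇∇/k²)g satisfies, as bilinear forms: g(y)⟨v, w⟩ + k⁻²·D²g(y)(v, w) = e^{−ikR}/(4πR)·(⟨v, w⟩ − ⟨u, v⟩⟨u, w⟩) − i·e^{−ikR}/(4πR²k)·(⟨v, w⟩ − 3⟨u, v⟩⟨u, w⟩) − e^{−ikR}/(4πR³k²)·(⟨v, w⟩ − 3⟨u, v⟩⟨u, w⟩) for all v, w ∈ ℝ³. -/

import Mathlib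

open MeasureTheory Metric Real RealInnerProductSpace

noncomputable def gHelm (k : ℝ) (y : EuclideanSpace ℝ (Fin 3)) : ℂ :=
  Complex.exp (-Complex.I * k * ‖y‖) / (4 * π * ‖y‖)

section Radial

variable {E F : Type*} [NormedAddCommGroup E] [InnerProductSpace ℝ E]
  [NormedAddCommGroup F] [NormedSpace ℝ F]

theorem hasFDerivAt_norm_of_ne_zero {y : E} (hy : y ≠ 0) :
    HasFDerivAt (fun x : E => ‖x‖) (‖y‖⁻¹ • innerSL ℝ y) y := by
  have hR : ‖y‖ ≠ 0 := norm_ne_zero_iff.mpr hy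
  have h := (hasStrictFDerivAt_norm_sq y).hasFDerivAt.sqrt (pow_ne_zero 2 hR)
  simp only [Real.sqrt_sq (norm_nonneg _)] at h
  convert! h using 1
  ext x
  simp
  field_simp

theorem HasDerivAt.hasFDerivAt_comp_norm {f : ℝ → F} {f' : F} {y : E} (hy : y ≠ 0)
    (hf : HasDerivAt f f' ‖y‖) :
    HasFDerivAt (fun x : E => f ‖x‖) ((innerSL ℝ y).smulRight (‖y‖⁻¹ • f')) y := by
  convert! hf.hasFDerivAt.comp y (hasFDerivAt_norm_of_ne_zero hy) using 1
  ext x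
  simp [smul_smul, mul_comm]

/-- The Hessian of a radial function `x ↦ f ‖x‖` away from the origin, in terms of the derivative
of `h r = r⁻¹ • f' r`. -/
theorem fderiv_fderiv_comp_norm_apply {f h : ℝ → F} {h' : F} {y : E} (hy : y ≠ 0)
    (hf : ∀ r, 0 < r → HasDerivAt f (r • h r) r) (hh : HasDerivAt h h' ‖y‖) (v w : E) :
    fderiv ℝ (fderiv ℝ fun x : E => f ‖x‖) y v w =
      ⟪v, w⟫ • h ‖y‖ + (‖y‖⁻¹ * ⟪y, v⟫ * ⟪y, w⟫) • h' := by
  have hgrad : fderiv ℝ (fun x : E => f ‖x‖) =ᶠ[nhds y]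
      fun x => ContinuousLinearMap.smulRightL ℝ E F (innerSL ℝ x) (h ‖x‖) := by
    filter_upwards [isOpen_ne.mem_nhds hy] with x hx
    have hx' : 0 < ‖x‖ := norm_pos_iff.mpr hx
    rw [((hf _ hx').hasFDerivAt_comp_norm hx).fderiv, inv_smul_smul₀ hx'.ne']
    rfl
  have hhess := (ContinuousLinearMap.smulRightL ℝ E F).hasFDerivAt_of_bilinear
    (innerSL ℝ (E := E)).hasFDerivAt (hh.hasFDerivAt_comp_norm hy)
  rw [hgrad.fderiv_eq, hhess.fderiv]
  change ⟪y, w⟫ • ⟪y, v⟫ • ‖y‖⁻¹ • h' + ⟪v, w⟫ • h ‖y‖ = _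
  module

end Radial

theorem hasDerivAt_cexp_neg_I_mul (k r : ℝ) :
    HasDerivAt (fun r : ℝ => Complex.exp (-Complex.I * k * r))
      (-Complex.I * k * Complex.exp (-Complex.I * k * r)) r := by
  have h := ((Complex.ofRealCLM.hasDerivAt (x := r)).const_mul (-Complex.I * k)).cexp
  simpa [mul_comm] using h

theorem hasDerivAt_helmholtz_profile (k : ℝ) {r : ℝ} (hr : r ≠ 0) :
    HasDerivAt (fun r : ℝ => Complex.exp (-Complex.I * k * r) / (4 * π * r))
      (r • (-(Complex.I * k * r + 1) * Complex.exp (-Complex.I * k * r) / (4 * π * r ^ 3))) r := by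
  have hr' : (r : ℂ) ≠ 0 := Complex.ofReal_ne_zero.mpr hr
  have hπ : (π : ℂ) ≠ 0 := Complex.ofReal_ne_zero.mpr pi_ne_zero
  have hid : HasDerivAt (fun r : ℝ => (r : ℂ)) 1 r := Complex.ofRealCLM.hasDerivAt
  convert! (hasDerivAt_cexp_neg_I_mul k r).div (hid.const_mul (4 * π : ℂ)) (by simp [hr]) using 1
  rw [Complex.real_smul]
  field_simp
  ring

theorem hasDerivAt_helmholtz_profile_deriv (k : ℝ) {r : ℝ} (hr : r ≠ 0) :
    HasDerivAt
      (fun r : ℝ => -(Complex.I * k * r + 1) * Complex.exp (-Complex.I * k * r) / (4 * π * r ^ 3))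
      ((3 + 3 * Complex.I * k * r - k ^ 2 * r ^ 2) * Complex.exp (-Complex.I * k * r) /
        (4 * π * r ^ 4)) r := by
  have hr' : (r : ℂ) ≠ 0 := Complex.ofReal_ne_zero.mpr hr
  have hπ : (π : ℂ) ≠ 0 := Complex.ofReal_ne_zero.mpr pi_ne_zero
  have hid : HasDerivAt (fun r : ℝ => (r : ℂ)) 1 r := Complex.ofRealCLM.hasDerivAt
  convert! ((((hid.const_mul (Complex.I * k)).add_const 1).neg).mul
    (hasDerivAt_cexp_neg_I_mul k r)).div ((hid.pow 3).const_mul (4 * π : ℂ)) (by simp [hr]) using 1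
  simp only [Pi.neg_apply, Pi.mul_apply, Pi.pow_apply]
  field_simp
  ring_nf
  simp only [Complex.I_sq]
  ring

theorem dyadic_green_function_explicit_form
    (k : ℝ) (hk : k ≠ 0) (y : EuclideanSpace ℝ (Fin 3)) (hy : y ≠ 0)
    (v w : EuclideanSpace ℝ (Fin 3)) :
    gHelm k y * (⟪v, w⟫ : ℝ) + ((k : ℂ) ^ 2)⁻¹ * fderiv ℝ (fderiv ℝ (gHelm k)) y v w =
      Complex.exp (-Complex.I * k * ‖y‖) / (4 * π * ‖y‖) *
        ((⟪v, w⟫ : ℝ) - (⟪‖y‖⁻¹ • y, v⟫ : ℝ) * (⟪‖y‖⁻¹ • y, w⟫ : ℝ))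
      - Complex.I * Complex.exp (-Complex.I * k * ‖y‖) / (4 * π * ‖y‖ ^ 2 * k) *
        ((⟪v, w⟫ : ℝ) - 3 * (⟪‖y‖⁻¹ • y, v⟫ : ℝ) * (⟪‖y‖⁻¹ • y, w⟫ : ℝ))
      - Complex.exp (-Complex.I * k * ‖y‖) / (4 * π * ‖y‖ ^ 3 * (k : ℂ) ^ 2) *
        ((⟪v, w⟫ : ℝ) - 3 * (⟪‖y‖⁻¹ • y, v⟫ : ℝ) * (⟪‖y‖⁻¹ • y, w⟫ : ℝ)) := by
  have hR : ‖y‖ ≠ 0 := norm_ne_zero_iff.mpr hy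
  have hR' : (‖y‖ : ℂ) ≠ 0 := Complex.ofReal_ne_zero.mpr hR
  have hk' : (k : ℂ) ≠ 0 := Complex.ofReal_ne_zero.mpr hk
  have hπ : (π : ℂ) ≠ 0 := Complex.ofReal_ne_zero.mpr pi_ne_zero
  have hhess : fderiv ℝ (fderiv ℝ (gHelm k)) y v w = _ :=
    fderiv_fderiv_comp_norm_apply hy (fun r hr => hasDerivAt_helmholtz_profile k hr.ne')
      (hasDerivAt_helmholtz_profile_deriv k hR) v w
  rw [hhess, gHelm]
  simp only [Complex.real_smul, real_inner_smul_left, Complex.ofReal_mul, Complex.ofReal_inv]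
  field_simp
  ring
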